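/- Let k be a field of characteristic 2, R = k[a,b,c,d]/(ad - bc - 1), B = k[ab, cd] ⊆ A = k[ab, ad, cd]. Then the extension of B-algebras B → A is étale (equivalently: A ≅ B[x]/(x^2 - x - ab·cd), and this is a standard étale/separable extension since the derivative 2x - 1 is a unit). -/

import Mathlib

open MvPolynomial

noncomputable section

/-- The polynomial ring `k[a,b,c,d]` (variables indexed by `Fin 4`). -/
abbrev P (k : Type*) [Field k] := MvPolynomial (Fin 4) k

/-- The ideal `(ad - bc - 1)`. -/
def sl2Rel (k : Type*) [Field k] : Ideal (P k) :=
  Ideal.span {X 0 * X 3 - X 1 * X 2 - 1}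

/-- `R = k[a,b,c,d]/(ad - bc - 1)`, the coordinate ring of `SL₂`. -/
abbrev R (k : Type*) [Field k] := P k ⧸ sl2Rel k

def va (k : Type*) [Field k] : R k := Ideal.Quotient.mk _ (X 0)
def vb (k : Type*) [Field k] : R k := Ideal.Quotient.mk _ (X 1)
def vc (k : Type*) [Field k] : R k := Ideal.Quotient.mk _ (X 2)
def vd (k : Type*) [Field k] : R k := Ideal.Quotient.mk _ (X 3)

set_option synthInstance.maxHeartbeats 1000000
set_option maxHeartbeats 1000000

/-- An algebra generated by one element `x` whose relations are exactly the multiples of a monic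
polynomial `f` whose derivative at `x` is a unit is étale. -/
theorem Algebra.Etale.of_adjoin_singleton_eq_top {S T : Type*} [CommRing S] [CommRing T]
    [Algebra S T] (f : Polynomial S) (hf : f.Monic) (x : T)
    (hx : Algebra.adjoin S {x} = ⊤) (hker : ∀ p : Polynomial S, Polynomial.aeval x p = 0 ↔ f ∣ p)
    (hunit : IsUnit (Polynomial.aeval x f.derivative)) : Algebra.Etale S T := by
  have hsurj : Function.Surjective (Polynomial.aeval (R := S) x) := by
    rwa [← AlgHom.range_eq_top, ← Algebra.adjoin_singleton_eq_range_aeval]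
  obtain ⟨u, hu⟩ := hunit.exists_right_inv
  obtain ⟨q, rfl⟩ := hsurj u
  obtain ⟨r, hr⟩ := (hker (f.derivative * q - 1)).1 (by simp [hu])
  let Q : StandardEtalePair S := ⟨f, hf, 1, q, -r, 0, by linear_combination hr⟩
  have hmap : Q.HasMap x := ⟨(hker f).2 dvd_rfl, by simp [Q]⟩
  let pres : StandardEtalePresentation S Q.Ring :=
    ⟨Q, Q.X, Q.hasMap_X, by simpa using Function.bijective_id⟩
  have hlift (p : Polynomial S) :
      Q.lift x hmap (Polynomial.aeval Q.X p) = Polynomial.aeval x p := by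
    rw [← Polynomial.aeval_algHom_apply, Q.lift_X]
  have hbij : Function.Bijective (Q.lift x hmap) := by
    refine ⟨(injective_iff_map_eq_zero _).2 fun z hz ↦ ?_, fun t ↦ ?_⟩
    · obtain ⟨p, n, hp⟩ := pres.exists_mul_aeval_x_g_pow_eq_aeval_x z
      have hzp : z = Polynomial.aeval Q.X p := by simpa [pres, Q] using hp
      rw [hzp, hlift, hker] at hz
      obtain ⟨s, rfl⟩ := hz
      have hroot : Polynomial.aeval Q.X f = 0 := Q.hasMap_X.1
      rw [hzp, map_mul, hroot, zero_mul]
    · obtain ⟨p, rfl⟩ := hsurj t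
      exact ⟨_, hlift p⟩
  exact .of_equiv (AlgEquiv.ofBijective _ hbij)

/-- If an algebra endomorphism moves a root `x` of a monic polynomial `f` of degree at most two by a
unit, then every polynomial relation of `x` is a multiple of `f`. -/
theorem Polynomial.Monic.aeval_eq_zero_iff_dvd_of_isUnit_sub {S T : Type*} [CommRing S]
    [CommRing T] [Algebra S T] [FaithfulSMul S T] {f : Polynomial S} (hf : f.Monic)
    (hdeg : f.natDegree ≤ 2) {x : T} (hx : Polynomial.aeval x f = 0) (σ : T →ₐ[S] T)
    (hσ : IsUnit (σ x - x)) (p : Polynomial S) : Polynomial.aeval x p = 0 ↔ f ∣ p := by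
  refine ⟨fun hp ↦ ?_, fun ⟨q, hq⟩ ↦ by rw [hq, map_mul, hx, zero_mul]⟩
  by_cases hf1 : f = 1
  · exact hf1 ▸ one_dvd p
  rw [← Polynomial.modByMonic_eq_zero_iff_dvd hf]
  have hr : Polynomial.aeval x (p %ₘ f) = 0 := by
    rw [Polynomial.modByMonic_eq_sub_mul_div, map_sub, map_mul, hx, zero_mul, hp, sub_zero]
  have hlt : (p %ₘ f).natDegree ≤ 1 := by
    have := Polynomial.natDegree_modByMonic_lt p hf hf1
    omega
  obtain ⟨b, c, hbc⟩ := Polynomial.exists_eq_X_add_C_of_natDegree_le_one hlt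
  rw [hbc] at hr ⊢
  have hr : algebraMap S T b * x + algebraMap S T c = 0 := by simpa using hr
  have hr' : algebraMap S T b * σ x + algebraMap S T c = 0 := by simpa using congrArg σ hr
  have hinj := FaithfulSMul.algebraMap_injective S T
  have hb : b = 0 := by
    apply hinj
    rw [map_zero, ← hσ.mul_left_eq_zero]
    linear_combination hr' - hr
  have hc : c = 0 := by
    apply hinj
    simpa [hb] using hr
  simp [hb, hc]

theorem va_mul_vd (k : Type*) [Field k] : va k * vd k = vb k * vc k + 1 := by
  have h : Ideal.Quotient.mk (sl2Rel k) (X 0 * X 3 - X 1 * X 2 - 1) = 0 :=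
    Ideal.Quotient.eq_zero_iff_mem.2 (Ideal.subset_span rfl)
  simp only [map_sub, map_mul, map_one] at h
  unfold va vb vc vd
  linear_combination h

theorem two_eq_zero (k : Type*) [Field k] [CharP k 2] : (2 : R k) = 0 := by
  have h := congrArg (algebraMap k (R k)) (CharTwo.two_eq_zero (R := k))
  rwa [map_ofNat, map_zero] at h

/-- In characteristic two, exchanging the columns of a matrix preserves the determinant. -/
def swapColumns (k : Type*) [Field k] [CharP k 2] : R k →ₐ[k] R k :=
  Ideal.Quotient.liftₐ (sl2Rel k) (aeval ![vb k, va k, vd k, vc k]) (by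
    change Ideal.span _ ≤ RingHom.ker _
    rw [Ideal.span_le, Set.singleton_subset_iff]
    simp only [SetLike.mem_coe, RingHom.mem_ker, map_sub, map_mul, map_one, aeval_X]
    change vb k * vc k - va k * vd k - 1 = 0
    linear_combination -va_mul_vd k - two_eq_zero k)

section swapColumns

variable (k : Type*) [Field k] [CharP k 2]

theorem swapColumns_va : swapColumns k (va k) = vb k := aeval_X _ 0

theorem swapColumns_vb : swapColumns k (vb k) = va k := aeval_X _ 1

theorem swapColumns_vc : swapColumns k (vc k) = vd k := aeval_X _ 2

theorem swapColumns_vd : swapColumns k (vd k) = vc k := aeval_X _ 3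

end swapColumns

/-- The extension `B = k[ab,cd] ⊆ A = k[ab,ad,cd]` is étale. -/
theorem stmt9 (k : Type*) [Field k] [CharP k 2]
    (B : Subalgebra k (R k)) (hB : B = Algebra.adjoin k {va k * vb k, vc k * vd k}) :
    Algebra.Etale B (Algebra.adjoin B {va k * vd k}) := by
  have hab : va k * vb k ∈ B := hB ▸ Algebra.subset_adjoin (by simp)
  have hcd : vc k * vd k ∈ B := hB ▸ Algebra.subset_adjoin (by simp)
  have hfix : B ≤ AlgHom.equalizer (swapColumns k) (AlgHom.id k (R k)) := by
    rw [hB, Algebra.adjoin_le_iff]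
    rintro _ (rfl | rfl)
    · simp [swapColumns_va, swapColumns_vb, mul_comm]
    · simp [swapColumns_vc, swapColumns_vd, mul_comm]
  let σ : R k →ₐ[B] R k :=
    { (swapColumns k : R k →+* R k) with commutes' := fun b ↦ hfix b.2 }
  have hσ : σ (va k * vd k) - va k * vd k = -1 := by
    change swapColumns k (va k * vd k) - va k * vd k = -1
    rw [map_mul, swapColumns_va, swapColumns_vd, va_mul_vd]
    ring
  let t : B := ⟨va k * vb k, hab⟩ * ⟨vc k * vd k, hcd⟩
  let f : Polynomial B := Polynomial.X ^ 2 - Polynomial.X - Polynomial.C t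
  have hdeg : f.natDegree ≤ 2 := by unfold f; compute_degree!
  have hf : f.Monic := by unfold f; monicity!
  have hroot : Polynomial.aeval (va k * vd k) f = 0 := by
    have ht : algebraMap B (R k) t = va k * vb k * (vc k * vd k) := rfl
    simp only [f, map_sub, map_pow, Polynomial.aeval_X, Polynomial.aeval_C, ht]
    linear_combination va k * vd k * va_mul_vd k
  let x : Algebra.adjoin B {va k * vd k} := ⟨va k * vd k, Algebra.self_mem_adjoin_singleton _ _⟩
  have hval (p : Polynomial B) :
      ((Polynomial.aeval x p : Algebra.adjoin B {va k * vd k}) : R k) =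
        Polynomial.aeval (va k * vd k) p :=
    (Polynomial.aeval_algHom_apply (Algebra.adjoin B {va k * vd k}).val x p).symm
  refine Algebra.Etale.of_adjoin_singleton_eq_top f hf x ?_ (fun p ↦ ?_) ?_
  · have hpre : ({x} : Set (Algebra.adjoin B {va k * vd k})) =
        Subtype.val ⁻¹' {va k * vd k} := by
      ext y
      simp [x, Subtype.ext_iff]
    rw [hpre]
    exact Algebra.adjoin_adjoin_coe_preimage
  · rw [← hf.aeval_eq_zero_iff_dvd_of_isUnit_sub hdeg hroot σ
      (.of_mul_eq_one (-1) (by rw [hσ]; ring)), ← hval, ZeroMemClass.coe_eq_zero]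
  · have hder : Polynomial.aeval x f.derivative = -1 := by
      apply Subtype.ext
      rw [hval]
      simp only [f, Polynomial.derivative_X_sq, Polynomial.derivative_X,
        Polynomial.derivative_C, map_sub, map_mul, map_ofNat, map_one, map_zero,
        Polynomial.aeval_X]
      change 2 * (va k * vd k) - 1 - 0 = -1
      linear_combination va k * vd k * two_eq_zero k
    exact .of_mul_eq_one (-1) (by rw [hder]; ring)
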